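/- Under the stated hypotheses, the main period of the perturbed Hamiltonian system depends continuously on the perturbation parameter at λ = 0: T_λ → T_g as λ → 0. -/

import Mathlib

open Filter Topology

/-- The first partial derivative of `f : ℝ × ℝ → ℝ`. -/
noncomputable def pd1 (f : ℝ × ℝ → ℝ) (x : ℝ × ℝ) : ℝ := fderiv ℝ f x (1, 0)

/-- The second partial derivative of `f : ℝ × ℝ → ℝ`. -/
noncomputable def pd2 (f : ℝ × ℝ → ℝ) (x : ℝ × ℝ) : ℝ := fderiv ℝ f x (0, 1)

/-- The Hamiltonian vector field of `G : ℝ × ℝ → ℝ`. -/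
noncomputable def hamiltonianField (G : ℝ × ℝ → ℝ) (x : ℝ × ℝ) : ℝ × ℝ := (-pd2 G x, pd1 G x)

lemma fderiv_apply_eq_pd (G : ℝ × ℝ → ℝ) (x u : ℝ × ℝ) :
    fderiv ℝ G x u = u.1 * pd1 G x + u.2 * pd2 G x := by
  have hu : u = u.1 • ((1, 0) : ℝ × ℝ) + u.2 • ((0, 1) : ℝ × ℝ) := by ext <;> simp
  conv_lhs => rw [hu, map_add, map_smul, map_smul]
  rfl

lemma hamiltonianField_add_smul {g r : ℝ × ℝ → ℝ} {x : ℝ × ℝ} (hg : DifferentiableAt ℝ g x)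
    (hr : DifferentiableAt ℝ r x) (l : ℝ) :
    hamiltonianField (fun y => g y + l * r y) x =
      hamiltonianField g x + l • hamiltonianField r x := by
  have h : fderiv ℝ (fun y => g y + l * r y) x = fderiv ℝ g x + l • fderiv ℝ r x :=
    (hg.hasFDerivAt.add (hr.hasFDerivAt.const_mul l)).fderiv
  ext
  · simp [hamiltonianField, pd2, h]
    ring
  · simp [hamiltonianField, pd1, h]

lemma contDiffOn_hamiltonianField {G : ℝ × ℝ → ℝ} {U : Set (ℝ × ℝ)} (hU : IsOpen U)
    (hG : ContDiffOn ℝ 2 G U) : ContDiffOn ℝ 1 (hamiltonianField G) U := by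
  have h : ContDiffOn ℝ 1 (fderiv ℝ G) U := hG.fderiv_of_isOpen hU (by norm_num)
  exact (h.clm_apply contDiffOn_const).neg.prodMk (h.clm_apply contDiffOn_const)

/-- A `C¹` function on an open set is Lipschitz on every compact subset. -/
lemma ContDiffOn.exists_lipschitzOnWith_of_isCompact_subset {E F : Type*}
    [NormedAddCommGroup E] [NormedSpace ℝ E] [NormedAddCommGroup F] [NormedSpace ℝ F]
    {f : E → F} {U K : Set E} (hU : IsOpen U) (hf : ContDiffOn ℝ 1 f U) (hK : IsCompact K)
    (hKU : K ⊆ U) : ∃ C, LipschitzOnWith C f K := by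
  refine LocallyLipschitzOn.exists_lipschitzOnWith_of_compact hK fun x hx => ?_
  obtain ⟨C, t, ht, hC⟩ :=
    (hf.contDiffAt (hU.mem_nhds (hKU hx))).exists_lipschitzOnWith
  exact ⟨C, t, mem_nhdsWithin_of_mem_nhds ht, hC⟩

/-- A Hamiltonian trajectory starting in `D` stays in `D` when the Hamiltonian is larger on the
boundary than at the starting point, and the Hamiltonian is conserved along it. -/
lemma hamiltonian_trajectory_mem {D U : Set (ℝ × ℝ)} (hDo : IsOpen D) (hUo : IsOpen U)
    (hDU : closure D ⊆ U) {G : ℝ × ℝ → ℝ} (hG : DifferentiableOn ℝ G U) {w : ℝ → ℝ × ℝ}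
    (hw : ∀ t, HasDerivAt w (hamiltonianField G (w t)) t) (hw0 : w 0 ∈ D)
    (hfr : ∀ x ∈ frontier D, G (w 0) < G x) (t : ℝ) : w t ∈ D ∧ G (w t) = G (w 0) := by
  have hwc : Continuous w := continuous_iff_continuousAt.2 fun t => (hw t).continuousAt
  have hclosed : IsClosed {t | w t ∈ D ∧ G (w t) = G (w 0)} := by
    have h1 : IsClosed (closure D ∩ G ⁻¹' {G (w 0)}) :=
      (hG.continuousOn.mono hDU).preimage_isClosed_of_isClosed isClosed_closure isClosed_singleton
    convert h1.preimage hwc using 1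
    ext s
    simp only [Set.mem_ofPred_eq, Set.mem_preimage, Set.mem_inter_iff, Set.mem_singleton_iff]
    refine ⟨fun h => ⟨subset_closure h.1, h.2⟩, fun h => ⟨?_, h.2⟩⟩
    by_contra hD
    have := hfr (w s) ⟨h.1, by rwa [hDo.interior_eq]⟩
    exact this.ne' h.2
  have hopen : IsOpen {t | w t ∈ D ∧ G (w t) = G (w 0)} := by
    refine Metric.isOpen_iff.2 fun s hs => ?_
    obtain ⟨e, he, hball⟩ := Metric.isOpen_iff.1 (hDo.preimage hwc) s hs.1
    refine ⟨e, he, fun s' hs' => ⟨hball hs', ?_⟩⟩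
    have hd : ∀ u ∈ Metric.ball s e, HasDerivAt (fun u => G (w u)) 0 u := by
      intro u hu
      have h1 := (hG.differentiableAt
        (hUo.mem_nhds (hDU (subset_closure (hball hu))))).hasFDerivAt.comp_hasDerivAt u (hw u)
      have h0 : fderiv ℝ G (w u) (hamiltonianField G (w u)) = 0 := by
        rw [fderiv_apply_eq_pd]
        simp only [hamiltonianField]
        ring
      rwa [h0] at h1
    rw [← hs.2]
    exact Metric.isOpen_ball.is_const_of_deriv_eq_zero (convex_ball s e).isPreconnected
      (fun u hu => (hd u hu).differentiableAt.differentiableWithinAt)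
      (fun u hu => (hd u hu).deriv) hs' (Metric.mem_ball_self he)
  exact Set.eq_univ_iff_forall.1 (IsClopen.eq_univ ⟨hclosed, hopen⟩ ⟨0, hw0, rfl⟩) t

section Perturbation

variable {E : Type*} [NormedAddCommGroup E] [NormedSpace ℝ E]

/-- Solutions of a perturbed equation converge uniformly on compact time intervals. -/
lemma eventually_dist_perturbed_trajectory_lt {v w : E → E} {K : Set E} {C : NNReal} {B : ℝ}
    (hv : LipschitzOnWith C v K) (hw : ∀ x ∈ K, ‖w x‖ ≤ B) {z : ℝ → E} {zl : ℝ → ℝ → E}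
    (hz : ∀ t, HasDerivAt z (v (z t)) t ∧ z t ∈ K)
    (hzl : ∀ᶠ l in 𝓝[≠] (0 : ℝ),
      ∀ t, HasDerivAt (zl l) (v (zl l t) + l • w (zl l t)) t ∧ zl l t ∈ K)
    (hzl0 : ∀ᶠ l in 𝓝[≠] (0 : ℝ), zl l 0 = z 0) (M : ℝ) {η : ℝ} (hη : 0 < η) :
    ∀ᶠ l in 𝓝[≠] (0 : ℝ), ∀ t ∈ Set.Icc 0 M, dist (zl l t) (z t) < η := by
  have hlim : Tendsto (fun l : ℝ => gronwallBound 0 C (|l| * B + 0) M) (𝓝[≠] 0) (𝓝 0) := by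
    have : Continuous fun l : ℝ => gronwallBound 0 C (|l| * B + 0) M :=
      (gronwallBound_continuous_ε 0 C M).comp (by fun_prop)
    refine (this.tendsto' 0 0 ?_).mono_left nhdsWithin_le_nhds
    simp [gronwallBound_ε0_δ0]
  have hB : 0 ≤ B := (norm_nonneg _).trans (hw _ (hz 0).2)
  filter_upwards [hzl, hzl0, hlim.eventually_lt_const hη] with l hl hl0 hlt t ht
  have h := dist_le_of_approx_trajectories_ODE_of_mem (v := fun _ => v) (s := fun _ => K)
    (f := zl l) (g := z) (a := 0) (b := M) (δ := 0) (εf := |l| * B) (εg := 0)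
    (fun _ _ => hv) (fun s _ => (hl s).1.continuousAt.continuousWithinAt)
    (fun s _ => (hl s).1.hasDerivWithinAt)
    (fun s _ => by
      rw [dist_eq_norm, add_sub_cancel_left, norm_smul, Real.norm_eq_abs]
      exact mul_le_mul_of_nonneg_left (hw _ (hl s).2) (abs_nonneg l))
    (fun s _ => (hl s).2) (fun s _ => (hz s).1.continuousAt.continuousWithinAt)
    (fun s _ => (hz s).1.hasDerivWithinAt) (fun s _ => (dist_self _).le)
    (fun s _ => (hz s).2) (by rw [hl0, dist_self]) t ht
  refine (h.trans ?_).trans_lt hlt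
  rw [sub_zero]
  exact gronwallBound_mono le_rfl (by positivity) C.2 ht.2

/-- If the limit trajectory does not return to its starting point on `(0, a]`, then neither do
nearby perturbed trajectories. -/
lemma eventually_perturbed_trajectory_ne {v w : E → E} {z : ℝ → E} {zl : ℝ → ℝ → E}
    (hz : Continuous z) (hv : ContinuousAt v (z 0)) (hw : ContinuousAt w (z 0))
    (L : E →L[ℝ] ℝ) (hL : 0 < L (v (z 0)))
    (hzl : ∀ᶠ l in 𝓝[≠] (0 : ℝ), ∀ t, HasDerivAt (zl l) (v (zl l t) + l • w (zl l t)) t)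
    (hzl0 : ∀ᶠ l in 𝓝[≠] (0 : ℝ), zl l 0 = z 0) {a : ℝ}
    (hunif : ∀ η > 0, ∀ᶠ l in 𝓝[≠] (0 : ℝ), ∀ t ∈ Set.Icc 0 a, dist (zl l t) (z t) < η)
    (hne : ∀ t ∈ Set.Ioc 0 a, z t ≠ z 0) :
    ∀ᶠ l in 𝓝[≠] (0 : ℝ), ∀ t ∈ Set.Ioc 0 a, zl l t ≠ z 0 := by
  have hφ : ContinuousAt (fun p : ℝ × E => L (v p.2 + p.1 • w p.2)) (0, z 0) := by
    have hv' : ContinuousAt (fun p : ℝ × E => v p.2) (0, z 0) :=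
      ContinuousAt.comp (f := Prod.snd) (x := ((0 : ℝ), z 0)) hv continuousAt_snd
    have hw' : ContinuousAt (fun p : ℝ × E => w p.2) (0, z 0) :=
      ContinuousAt.comp (f := Prod.snd) (x := ((0 : ℝ), z 0)) hw continuousAt_snd
    exact L.continuous.continuousAt.comp (hv'.add (continuousAt_fst.smul hw'))
  obtain ⟨η, hη, hpos⟩ := Metric.eventually_nhds_iff.1
    (hφ.eventually_const_lt (u := 0) (by simpa using hL))
  obtain ⟨c, hc, hcz⟩ := Metric.continuousAt_iff.1 hz.continuousAt (η / 2) (half_pos hη)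
  obtain ⟨m, hm, hfar⟩ : ∃ m > 0, ∀ t ∈ Set.Icc (c / 2) a, m ≤ dist (z t) (z 0) := by
    rcases (Set.Icc (c / 2) a).eq_empty_or_nonempty with h | h
    · exact ⟨1, one_pos, by simp [h]⟩
    obtain ⟨t₀, ht₀, hmin⟩ := isCompact_Icc.exists_isMinOn h
      (f := fun t => dist (z t) (z 0)) (by fun_prop)
    exact ⟨_, dist_pos.2 (hne t₀ ⟨by linarith [ht₀.1], ht₀.2⟩), fun t ht => hmin ht⟩
  have hsmall : ∀ᶠ l in 𝓝[≠] (0 : ℝ), |l| < η := by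
    refine nhdsWithin_le_nhds ?_
    filter_upwards [Metric.ball_mem_nhds (0 : ℝ) hη] with l hl
    simpa using hl
  filter_upwards [hzl, hzl0, hunif (η / 2) (half_pos hη), hunif m hm, hsmall]
    with l hl hl0 h1 h2 hlη t ht heq
  rcases le_total (c / 2) t with hct | hct
  · have := hfar t ⟨hct, ht.2⟩
    have h3 := h2 t ⟨ht.1.le, ht.2⟩
    rw [heq, dist_comm] at h3
    linarith
  · have hd : ∀ s, HasDerivAt (fun s => L (zl l s)) (L (v (zl l s) + l • w (zl l s))) s :=
      fun s => L.hasFDerivAt.comp_hasDerivAt s (hl s)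
    obtain ⟨s, hs, hs0⟩ := exists_hasDerivAt_eq_zero ht.1
      (fun s _ => (hd s).continuousAt.continuousWithinAt) (by simp only [heq, hl0])
      (fun s _ => hd s)
    refine (hpos (y := (l, zl l s)) ?_).ne' hs0
    have h3 := h1 s ⟨hs.1.le, hs.2.le.trans ht.2⟩
    have h4 : dist (z s) (z 0) < η / 2 := hcz (by
      rw [Real.dist_eq, sub_zero, abs_of_pos hs.1]; linarith [hs.2])
    rw [Prod.dist_eq]
    refine max_lt (by simpa using hlη) ?_
    linarith [dist_triangle (zl l s) (z s) (z 0)]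

/-- If the limit trajectory returns to its starting point at time `S`, crossing a transversal
on which the starting point is isolated among the admissible points, then nearby perturbed
trajectories return to the starting point soon after, or before, `S`. -/
lemma eventually_exists_perturbed_trajectory_return {z z' : ℝ → E} {zl : ℝ → ℝ → E}
    (hz : ∀ t, HasDerivAt z (z' t) t) {S b : ℝ} (hS : 0 < S) (hSb : S < b) (hret : z S = z 0)
    (L : E →L[ℝ] ℝ) (hL : 0 < L (z' S))
    (hzl : ∀ᶠ l in 𝓝[≠] (0 : ℝ), Continuous (zl l))
    (hunif : ∀ η > 0, ∀ᶠ l in 𝓝[≠] (0 : ℝ), ∀ t ∈ Set.Icc 0 b, dist (zl l t) (z t) < η)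
    {Q : ℝ → E → Prop}
    (hQ : ∀ᶠ p : ℝ × E in 𝓝 (0, z 0), L (p.2 - z 0) = 0 → Q p.1 p.2 → p.2 = z 0)
    (hzQ : ∀ᶠ l in 𝓝[≠] (0 : ℝ), ∀ t, Q l (zl l t)) :
    ∀ᶠ l in 𝓝[≠] (0 : ℝ), ∃ t ∈ Set.Ioo 0 b, zl l t = z 0 := by
  obtain ⟨η, hη, hQ⟩ := Metric.eventually_nhds_iff.1 hQ
  obtain ⟨c, hc, hcz⟩ := Metric.continuousAt_iff.1 (hz S).continuousAt (η / 2) (half_pos hη)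
  have hslope : ∀ᶠ s in 𝓝[≠] S, 0 < slope (fun s => L (z s)) S s :=
    (hasDerivAt_iff_tendsto_slope.1
      (L.hasFDerivAt.comp_hasDerivAt S (hz S))).eventually_const_lt hL
  obtain ⟨d, hd, hslope⟩ := Metric.eventually_nhds_iff.1 (eventually_nhdsWithin_iff.1 hslope)
  set e := min (min c d) (min S (b - S)) / 2 with he
  have he0 : 0 < e := by
    have : 0 < b - S := by linarith
    positivity
  have hec : e < c := by grind
  have hed : e < d := by grind
  have heS : e < S := by grind
  have heb : e < b - S := by grind
  have hlow : L (z (S - e)) < L (z 0) := by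
    have h := hslope (y := S - e) (by simpa [Real.dist_eq, abs_of_pos he0] using hed)
      (by simp [he0.ne'])
    rw [slope_def_field, hret] at h
    by_contra hcon
    exact absurd h (not_lt.2 (div_nonpos_of_nonneg_of_nonpos (by linarith) (by linarith)))
  have hhigh : L (z 0) < L (z (S + e)) := by
    have h := hslope (y := S + e) (by simpa [Real.dist_eq, abs_of_pos he0] using hed)
      (by simp [he0.ne'])
    rw [slope_def_field, hret] at h
    by_contra hcon
    exact absurd h (not_lt.2 (div_nonpos_of_nonpos_of_nonneg (by linarith) (by linarith)))
  have htend : ∀ t ∈ Set.Icc 0 b, Tendsto (fun l => L (zl l t)) (𝓝[≠] 0) (𝓝 (L (z t))) := by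
    intro t ht
    refine (L.continuous.tendsto (z t)).comp (Metric.tendsto_nhds.2 fun ε hε => ?_)
    filter_upwards [hunif ε hε] with l hl using hl t ht
  have hsmall : ∀ᶠ l in 𝓝[≠] (0 : ℝ), |l| < η := by
    refine nhdsWithin_le_nhds ?_
    filter_upwards [Metric.ball_mem_nhds (0 : ℝ) hη] with l hl
    simpa using hl
  filter_upwards [hzl, hzQ, hunif (η / 2) (half_pos hη), hsmall,
    (htend (S - e) ⟨by linarith, by linarith⟩).eventually_lt_const hlow,
    (htend (S + e) ⟨by linarith, by linarith⟩).eventually_const_lt hhigh]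
    with l hlc hlQ hlu hlη h1 h2
  obtain ⟨t, ht, hLt⟩ := intermediate_value_Icc (by linarith : S - e ≤ S + e)
    (L.continuous.comp hlc).continuousOn ⟨h1.le, h2.le⟩
  have ht0 : 0 < t := by linarith [ht.1]
  have htb : t < b := by linarith [ht.2]
  refine ⟨t, ⟨ht0, htb⟩, hQ (y := (l, zl l t)) ?_ ?_ (hlQ t)⟩
  · have h3 := hlu t ⟨ht0.le, htb.le⟩
    have h4 : dist (z t) (z S) < η / 2 := hcz (by
      rw [Real.dist_eq, abs_lt]; constructor <;> linarith [ht.1, ht.2])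
    rw [hret] at h4
    rw [Prod.dist_eq]
    refine max_lt (by simpa using hlη) ?_
    linarith [dist_triangle (zl l t) (z t) (z 0)]
  · simpa [sub_eq_zero] using hLt

/-- On a hyperplane `ker L` through `x` on which the derivative of `g` is nondegenerate, `x` is
isolated in its level set, uniformly under small perturbations `g + l * r`. -/
lemma eventually_perturbed_level_eq {g r : E → ℝ} {x : E} {A : E →L[ℝ] ℝ}
    (hg : HasFDerivAt g A x) (hr : DifferentiableAt ℝ r x) (L : E →L[ℝ] ℝ) {κ : ℝ} (hκ : 0 < κ)
    (hA : ∀ u, L u = 0 → κ * ‖u‖ ≤ |A u|) :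
    ∀ᶠ p : ℝ × E in 𝓝 (0, x),
      L (p.2 - x) = 0 → g p.2 + p.1 * r p.2 = g x + p.1 * r x → p.2 = x := by
  obtain ⟨C, hC0, hC⟩ := hr.hasFDerivAt.isBigO_sub.exists_pos
  have h1 : ∀ᶠ y in 𝓝 x, ‖g y - g x - A (y - x)‖ ≤ κ / 3 * ‖y - x‖ :=
    hg.isLittleO.def (by positivity)
  have h2 : ∀ᶠ l in 𝓝 (0 : ℝ), |l| * C < κ / 3 :=
    (show Continuous fun l : ℝ => |l| * C by fun_prop).tendsto' 0 0 (by simp)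
      |>.eventually_lt_const (by positivity)
  rw [nhds_prod_eq]
  filter_upwards [h2.prod_mk (h1.and hC.bound)] with p hp hLp hlev
  obtain ⟨hl, hgp, hrp⟩ := hp
  by_contra hne
  have hpos : 0 < ‖p.2 - x‖ := norm_pos_iff.2 (sub_ne_zero.2 hne)
  have hAp := hA _ hLp
  rw [Real.norm_eq_abs] at hgp hrp
  have h3 : |g p.2 - g x| ≤ κ / 3 * ‖p.2 - x‖ := by
    have : g p.2 - g x = -(p.1 * (r p.2 - r x)) := by linarith
    rw [this, abs_neg, abs_mul]
    calc |p.1| * |r p.2 - r x| ≤ |p.1| * (C * ‖p.2 - x‖) := by gcongr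
      _ = |p.1| * C * ‖p.2 - x‖ := by ring
      _ ≤ _ := by gcongr
  have h4 : |A (p.2 - x)| ≤ |g p.2 - g x| + |g p.2 - g x - A (p.2 - x)| := by
    have := abs_sub (g p.2 - g x) (g p.2 - g x - A (p.2 - x))
    rwa [sub_sub_cancel] at this
  have := mul_pos hκ hpos
  linarith

/-- An autonomous trajectory returning to its starting point is periodic. -/
lemma trajectory_periodic_of_return {v : E → E} {K : Set E} {C : NNReal}
    (hv : LipschitzOnWith C v K) {w : ℝ → E} (hw : ∀ t, HasDerivAt w (v (w t)) t ∧ w t ∈ K)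
    {S : ℝ} (hS : w S = w 0) (t : ℝ) : w (t + S) = w t := by
  have h := ODE_solution_unique_univ (v := fun _ => v) (s := fun _ => K) (t₀ := 0)
    (f := fun t => w (t + S)) (g := w) (fun _ => hv)
    (fun t => ⟨(hw (t + S)).1.comp_add_const t S, (hw (t + S)).2⟩) hw (by simpa using hS)
  exact congrFun h t

end Perturbation

/-- The main period of the perturbed Hamiltonian system depends
continuously on the perturbation parameter at `λ = 0`: `T_λ → T_g` as `λ → 0`. -/
theorem period_continuous_in_perturbation
    (D : Set (ℝ × ℝ)) (hDo : IsOpen D) (hDb : Bornology.IsBounded D)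
    (hDc : IsConnected D)
    (g r : ℝ × ℝ → ℝ)
    (U : Set (ℝ × ℝ)) (hUo : IsOpen U) (hDU : closure D ⊆ U)
    (hg : ContDiffOn ℝ 2 g U) (hr : ContDiffOn ℝ 2 r U)
    (hpos : ∀ x ∈ frontier D, 0 < g x)
    (hgrad : ∀ x ∈ D, g x = 0 → fderiv ℝ g x ≠ 0)
    (x₀ : ℝ × ℝ) (hx₀ : x₀ ∈ D) (hgx₀ : g x₀ = 0)
    -- the periodic solution `z` with main period `Tg`
    (Tg : ℝ) (hTg : 0 < Tg) (z : ℝ → ℝ × ℝ)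
    (hz1 : ∀ t : ℝ, HasDerivAt (fun s => (z s).1) (-pd2 g (z t)) t)
    (hz2 : ∀ t : ℝ, HasDerivAt (fun s => (z s).2) (pd1 g (z t)) t)
    (hz0 : z 0 = x₀)
    (hper : ∀ t : ℝ, z (t + Tg) = z t)
    (hmin : ∀ T : ℝ, 0 < T → (∀ t : ℝ, z (t + T) = z t) → Tg ≤ T)
    -- the perturbed periodic solutions `zl λ` with main periods `T λ`, for `λ` near `0`
    (ε : ℝ) (hε : 0 < ε) (zl : ℝ → ℝ → ℝ × ℝ) (T : ℝ → ℝ)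
    (hzl1 : ∀ l : ℝ, |l| < ε → l ≠ 0 → ∀ t : ℝ,
      HasDerivAt (fun s => (zl l s).1) (-pd2 (fun y => g y + l * r y) (zl l t)) t)
    (hzl2 : ∀ l : ℝ, |l| < ε → l ≠ 0 → ∀ t : ℝ,
      HasDerivAt (fun s => (zl l s).2) (pd1 (fun y => g y + l * r y) (zl l t)) t)
    (hzl0 : ∀ l : ℝ, |l| < ε → l ≠ 0 → zl l 0 = x₀)
    (hTl : ∀ l : ℝ, |l| < ε → l ≠ 0 → 0 < T l)
    (hperl : ∀ l : ℝ, |l| < ε → l ≠ 0 → ∀ t : ℝ, zl l (t + T l) = zl l t)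
    (hminl : ∀ l : ℝ, |l| < ε → l ≠ 0 →
      ∀ S : ℝ, 0 < S → (∀ t : ℝ, zl l (t + S) = zl l t) → T l ≤ S) :
    Tendsto T (𝓝[≠] (0 : ℝ)) (𝓝 Tg) := by
  have hK : IsCompact (closure D) := hDb.isCompact_closure
  have hgd : DifferentiableOn ℝ g U := hg.differentiableOn (by norm_num)
  have hrd : DifferentiableOn ℝ r U := hr.differentiableOn (by norm_num)
  have hfg := contDiffOn_hamiltonianField hUo hg
  have hfr := contDiffOn_hamiltonianField hUo hr
  have hx₀U : x₀ ∈ U := hDU (subset_closure hx₀)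
  obtain ⟨Cg, hCg⟩ := hfg.exists_lipschitzOnWith_of_isCompact_subset hUo hK hDU
  obtain ⟨Cr, hCr⟩ := hfr.exists_lipschitzOnWith_of_isCompact_subset hUo hK hDU
  obtain ⟨B, hB⟩ := hK.exists_bound_of_continuousOn (hfr.continuousOn.mono hDU)
  have hzd : ∀ t, HasDerivAt z (hamiltonianField g (z t)) t := fun t => (hz1 t).prodMk (hz2 t)
  have hzD : ∀ t, HasDerivAt z (hamiltonianField g (z t)) t ∧ z t ∈ closure D := fun t =>
    ⟨hzd t, subset_closure (hamiltonian_trajectory_mem hDo hUo hDU hgd hzd (hz0 ▸ hx₀)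
      (by rw [hz0, hgx₀]; exact hpos) t).1⟩
  have hεn : ∀ᶠ l in 𝓝[≠] (0 : ℝ), |l| < ε ∧ l ≠ 0 := by
    filter_upwards [self_mem_nhdsWithin, nhdsWithin_le_nhds (Metric.ball_mem_nhds (0 : ℝ) hε)]
      with l h1 h2
    exact ⟨by simpa using h2, h1⟩
  have hbdry : ∀ᶠ l in 𝓝[≠] (0 : ℝ), ∀ x ∈ frontier D, g x₀ + l * r x₀ < g x + l * r x := by
    refine nhdsWithin_le_nhds ((hK.of_isClosed_subset isClosed_frontier
      frontier_subset_closure).eventually_forall_of_forall_eventually fun x hx => ?_)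
    have hxU := hUo.mem_nhds (hDU (frontier_subset_closure hx))
    have hgc : ContinuousAt (fun p : ℝ × (ℝ × ℝ) => g p.2) (0, x) :=
      ContinuousAt.comp (f := Prod.snd) (x := ((0 : ℝ), x))
        (hgd.continuousOn.continuousAt hxU) continuousAt_snd
    have hrc : ContinuousAt (fun p : ℝ × (ℝ × ℝ) => r p.2) (0, x) :=
      ContinuousAt.comp (f := Prod.snd) (x := ((0 : ℝ), x))
        (hrd.continuousOn.continuousAt hxU) continuousAt_snd
    exact ContinuousAt.eventually_lt
      (continuousAt_const.add (continuousAt_fst.mul continuousAt_const))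
      (hgc.add (continuousAt_fst.mul hrc)) (by simpa [hgx₀] using hpos x hx)
  have hzl0' : ∀ᶠ l in 𝓝[≠] (0 : ℝ), zl l 0 = z 0 := by
    filter_upwards [hεn] with l hl
    rw [hz0, hzl0 l hl.1 hl.2]
  have hzlD : ∀ᶠ l in 𝓝[≠] (0 : ℝ), ∀ t,
      (HasDerivAt (zl l) (hamiltonianField g (zl l t) + l • hamiltonianField r (zl l t)) t ∧
        zl l t ∈ closure D) ∧
      g (zl l t) + l * r (zl l t) = g (z 0) + l * r (z 0) := by
    filter_upwards [hεn, hbdry] with l hl hlb t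
    have hd : ∀ t, HasDerivAt (zl l) (hamiltonianField (fun y => g y + l * r y) (zl l t)) t :=
      fun t => (hzl1 l hl.1 hl.2 t).prodMk (hzl2 l hl.1 hl.2 t)
    have h0 := hzl0 l hl.1 hl.2
    have hmem := hamiltonian_trajectory_mem hDo hUo hDU (hgd.add (hrd.const_mul l)) hd
      (h0 ▸ hx₀) (by rw [h0]; exact hlb) t
    have hU := hUo.mem_nhds (hDU (subset_closure hmem.1))
    refine ⟨⟨?_, subset_closure hmem.1⟩, ?_⟩
    · rw [← hamiltonianField_add_smul (hgd.differentiableAt hU) (hrd.differentiableAt hU)]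
      exact hd t
    · have := hmem.2
      rw [h0] at this
      rw [hz0]
      exact this
  have hzlK := hzlD.mono fun l h t => (h t).1
  have hunif : ∀ M, ∀ η > 0, ∀ᶠ l in 𝓝[≠] (0 : ℝ),
      ∀ t ∈ Set.Icc 0 M, dist (zl l t) (z t) < η := fun M η hη =>
    eventually_dist_perturbed_trajectory_lt hCg hB hzD hzlK hzl0' M hη
  set a := pd1 g x₀ with ha
  set b := pd2 g x₀ with hb
  have hab : 0 < a ^ 2 + b ^ 2 := by
    by_contra hcon
    have ha0 : a = 0 := by nlinarith [sq_nonneg a, sq_nonneg b]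
    have hb0 : b = 0 := by nlinarith [sq_nonneg a, sq_nonneg b]
    refine hgrad x₀ hx₀ hgx₀ (ContinuousLinearMap.ext fun u => ?_)
    rw [fderiv_apply_eq_pd, ← ha, ← hb, ha0, hb0]
    simp
  -- The functional whose kernel is the line through the gradient of `g` at `x₀`.
  let L : ℝ × ℝ →L[ℝ] ℝ :=
    (-b) • ContinuousLinearMap.fst ℝ ℝ ℝ + a • ContinuousLinearMap.snd ℝ ℝ ℝ
  have hLap : ∀ u, L u = -b * u.1 + a * u.2 := fun u => by simp [L]
  have hL : 0 < L (hamiltonianField g x₀) := by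
    rw [hLap]
    simp only [hamiltonianField, ← ha, ← hb]
    linarith
  have hsum : 0 < |a| + |b| := by
    by_contra hcon
    have ha0 : a = 0 := abs_eq_zero.1 (by linarith [abs_nonneg a, abs_nonneg b])
    have hb0 : b = 0 := abs_eq_zero.1 (by linarith [abs_nonneg a, abs_nonneg b])
    simp [ha0, hb0] at hab
  have hnondeg : ∀ u, L u = 0 → (a ^ 2 + b ^ 2) / (|a| + |b|) * ‖u‖ ≤ |fderiv ℝ g x₀ u| := by
    intro u hu
    rw [hLap] at hu
    rw [fderiv_apply_eq_pd, ← ha, ← hb, div_mul_eq_mul_div, div_le_iff₀ hsum, Prod.norm_def,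
      mul_max_of_nonneg _ _ hab.le, Real.norm_eq_abs, Real.norm_eq_abs]
    have hab' := abs_of_pos hab
    have h1 : (a ^ 2 + b ^ 2) * |u.1| = |u.1 * a + u.2 * b| * |a| := by
      rw [← hab', ← abs_mul, ← abs_mul]
      congr 1
      linear_combination -b * hu
    have h2 : (a ^ 2 + b ^ 2) * |u.2| = |u.1 * a + u.2 * b| * |b| := by
      rw [← hab', ← abs_mul, ← abs_mul]
      congr 1
      linear_combination a * hu
    rw [h1, h2, mul_add]
    exact max_le (le_add_of_nonneg_right (by positivity)) (le_add_of_nonneg_left (by positivity))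
  have hUx := hUo.mem_nhds hx₀U
  have hzTg : z Tg = z 0 := by simpa using hper 0
  refine tendsto_order.2 ⟨fun c hc => ?_, fun c hc => ?_⟩
  · have hne : ∀ t ∈ Set.Ioc 0 c, z t ≠ z 0 := fun t ht heq =>
      (hmin t ht.1 (trajectory_periodic_of_return hCg hzD heq)).not_gt (ht.2.trans_lt hc)
    have hev := eventually_perturbed_trajectory_ne
      (continuous_iff_continuousAt.2 fun t => (hzd t).continuousAt)
      (hz0 ▸ hfg.continuousOn.continuousAt hUx) (hz0 ▸ hfr.continuousOn.continuousAt hUx) L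
      (by rw [hz0]; exact hL) (hzlK.mono fun l h t => (h t).1) hzl0' (hunif c) hne
    filter_upwards [hev, hzl0', hεn] with l hl hl0 hlε
    by_contra hcon
    refine hl (T l) ⟨hTl l hlε.1 hlε.2, not_lt.1 hcon⟩ ?_
    rw [← hl0]
    simpa using hperl l hlε.1 hlε.2 0
  · have hev := eventually_exists_perturbed_trajectory_return hzd hTg hc hzTg L
      (by rw [hzTg, hz0]; exact hL)
      (hzlK.mono fun l h => continuous_iff_continuousAt.2 fun t => (h t).1.continuousAt)
      (hunif c)
      (Q := fun l y => g y + l * r y = g (z 0) + l * r (z 0))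
      (by
        rw [hz0]
        exact eventually_perturbed_level_eq (hgd.differentiableAt hUx).hasFDerivAt
          (hrd.differentiableAt hUx) L (div_pos hab hsum) hnondeg)
      (hzlD.mono fun l h t => (h t).2)
    filter_upwards [hev, hzlK, hzl0', hεn] with l hl hlK hl0 hlε
    obtain ⟨t, ht, hlt⟩ := hl
    have hlip := hCg.add ((lipschitzWith_smul l).comp_lipschitzOnWith hCr)
    exact (hminl l hlε.1 hlε.2 t ht.1
      (trajectory_periodic_of_return hlip hlK (hlt.trans hl0.symm))).trans_lt ht.2
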